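/- arXiv:2210.04273 — 2 statements merged into one kernel-verified Lean document; each statement's English description precedes it below -/
import Mathlib

section
/- Let n ≥ 1, ν > 0, let u be a standard Gaussian random vector with law N(0, I_n) on ℝ^n, let ξ be a random element independent of u, and let F(·, ξ) : ℝ^n → ℝ be a jointly measurable random function such that for every x ∈ ℝ^n: E[F(x, ξ)] = f(x), E[F(x, ξ)²] ≤ σ_f², F(·, ξ) is M-Lipschitz almost surely, and F(·, ξ) has an L-Lipschitz gradient almost surely. Let f_ν(x) = E[f(x + ν u)] be the Gaussian smoothing of f. Then for every x ∈ ℝ^n, E[ ( F(x + ν u, ξ) − f_ν(x) )² ] ≤ 4 M² ν² (n+2) + 2 σ_f² + L² ν⁴ n². -/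
open MeasureTheory ProbabilityTheory Real Finset
open scoped RealInnerProductSpace

noncomputable section

/-- `u` is a standard Gaussian random vector with law `N(0, I_n)` on `ℝⁿ`. -/
def IsStdGaussian {Ω : Type*} [MeasurableSpace Ω] (P : Measure Ω) {n : ℕ}
    (u : Ω → EuclideanSpace ℝ (Fin n)) : Prop :=
  Measure.map (fun ω => (fun i => u ω i)) P = Measure.pi fun _ : Fin n => gaussianReal 0 1

namespace IsStdGaussian

variable {Ω : Type*} [MeasurableSpace Ω] {P : Measure Ω} {n : ℕ}
  {u : Ω → EuclideanSpace ℝ (Fin n)}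

lemma hasLaw_apply (hu : IsStdGaussian P u) (hmeas : Measurable u) (i : Fin n) :
    HasLaw (fun ω => u ω i) (gaussianReal 0 1) P where
  aemeasurable := by fun_prop
  map_eq := by
    have h := (measurePreserving_eval (fun _ : Fin n => gaussianReal 0 1) i).map_eq
    rw [← hu, Measure.map_map (by fun_prop) (by fun_prop)] at h
    exact h

lemma memLp_apply (hu : IsStdGaussian P u) (hmeas : Measurable u) (i : Fin n) :
    MemLp (fun ω => u ω i) 2 P := by
  have h : MemLp id 2 (P.map fun ω => u ω i) := by
    rw [(hu.hasLaw_apply hmeas i).map_eq]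
    exact memLp_id_gaussianReal 2
  exact h.comp_of_map (by fun_prop)

lemma integral_apply_sq (hu : IsStdGaussian P u) (hmeas : Measurable u) (i : Fin n) :
    ∫ ω, u ω i ^ 2 ∂P = 1 := by
  have h : ∫ x, x ^ 2 ∂(gaussianReal 0 1) = 1 := by
    rw [← variance_of_integral_eq_zero (X := fun x : ℝ => x) (by fun_prop)
      integral_id_gaussianReal, variance_fun_id_gaussianReal, NNReal.coe_one]
  rw [← (hu.hasLaw_apply hmeas i).map_eq, integral_map (by fun_prop) (by fun_prop)] at h
  exact h

lemma integrable_norm_sq (hu : IsStdGaussian P u) (hmeas : Measurable u) :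
    Integrable (fun ω => ‖u ω‖ ^ 2) P := by
  simp_rw [EuclideanSpace.real_norm_sq_eq]
  exact integrable_finsetSum _ fun i _ => (hu.memLp_apply hmeas i).integrable_sq

lemma integral_norm_sq (hu : IsStdGaussian P u) (hmeas : Measurable u) :
    ∫ ω, ‖u ω‖ ^ 2 ∂P = n := by
  simp_rw [EuclideanSpace.real_norm_sq_eq]
  rw [integral_finsetSum _ fun i _ => (hu.memLp_apply hmeas i).integrable_sq]
  simp [hu.integral_apply_sq hmeas]

end IsStdGaussian

lemma integral_comp_of_indepFun {Ω α β : Type*} [MeasurableSpace Ω] [MeasurableSpace α]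
    [MeasurableSpace β] {P : Measure Ω} [IsProbabilityMeasure P] {X : Ω → α} {Y : Ω → β}
    (hX : Measurable X) (hY : Measurable Y) (hXY : IndepFun X Y P) {g : α → β → ℝ}
    (hg : Measurable (Function.uncurry g)) (hgint : Integrable (fun ω => g (X ω) (Y ω)) P) :
    ∫ ω, g (X ω) (Y ω) ∂P = ∫ ω, ∫ ω', g (X ω) (Y ω') ∂P ∂P := by
  have hmap := (indepFun_iff_map_prod_eq_prod_map_map hX.aemeasurable hY.aemeasurable).1 hXY
  have := Measure.isProbabilityMeasure_map (μ := P) hX.aemeasurable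
  have := Measure.isProbabilityMeasure_map (μ := P) hY.aemeasurable
  have hgint' : Integrable (Function.uncurry g) ((P.map X).prod (P.map Y)) := by
    rw [← hmap, integrable_map_measure hg.aestronglyMeasurable (by fun_prop)]
    exact hgint
  calc ∫ ω, g (X ω) (Y ω) ∂P
      = ∫ p, Function.uncurry g p ∂(P.map fun ω => (X ω, Y ω)) := by
        rw [integral_map (by fun_prop) hg.aestronglyMeasurable]
        rfl
    _ = ∫ a, ∫ b, g a b ∂(P.map Y) ∂(P.map X) := by
        rw [hmap, integral_prod _ hgint']
        rfl
    _ = ∫ ω, ∫ b, g (X ω) b ∂(P.map Y) ∂P :=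
        integral_map hX.aemeasurable hgint'.integral_prod_left.aestronglyMeasurable
    _ = ∫ ω, ∫ ω', g (X ω) (Y ω') ∂P ∂P := by
        congr with ω
        exact integral_map hY.aemeasurable
          (hg.comp measurable_prodMk_left).aestronglyMeasurable

/-- A perturbation `Y` of `G` has variance at most `2 E[(Y - G)²] + 2 E[G²]`. -/
lemma variance_le_two_mul_integral_sq_add {Ω : Type*} [MeasurableSpace Ω] {P : Measure Ω}
    [IsProbabilityMeasure P] {Y G : Ω → ℝ} (hY : MemLp Y 2 P) (hG : MemLp G 2 P) :
    Var[Y; P] ≤ 2 * ∫ ω, (Y ω - G ω) ^ 2 ∂P + 2 * ∫ ω, G ω ^ 2 ∂P := by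
  have hYG : Integrable (fun ω => (Y ω - G ω) ^ 2) P := (hY.sub hG).integrable_sq
  calc Var[Y; P] ≤ ∫ ω, Y ω ^ 2 ∂P := variance_le_expectation_sq hY.aestronglyMeasurable
    _ ≤ ∫ ω, (2 * (Y ω - G ω) ^ 2 + 2 * G ω ^ 2) ∂P := by
        refine integral_mono hY.integrable_sq
          ((hYG.const_mul 2).add (hG.integrable_sq.const_mul 2)) fun ω => ?_
        nlinarith [sq_nonneg (Y ω - G ω - G ω)]
    _ = 2 * ∫ ω, (Y ω - G ω) ^ 2 ∂P + 2 * ∫ ω, G ω ^ 2 ∂P := by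
        rw [integral_add (hYG.const_mul 2) (hG.integrable_sq.const_mul 2),
          integral_const_mul, integral_const_mul]

/-- for a single noisy function `F` with unbiased evaluations, bounded
second moment, a.s. `M`-Lipschitz and a.s. `L`-Lipschitz gradient, the expectation of
`(F(x + ν u, ξ) − f_ν(x))²` is bounded by `4 M² ν² (n+2) + 2 σ_f² + L² ν⁴ n²`. -/
theorem statement1
    {n : ℕ} (hn : 1 ≤ n)
    {Ω : Type*} [MeasurableSpace Ω] (P : Measure Ω) [IsProbabilityMeasure P]
    {𝓧 : Type*} [MeasurableSpace 𝓧]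
    (ν M L σf : ℝ) (hν : 0 < ν)
    (u : Ω → EuclideanSpace ℝ (Fin n))
    (hu : IsStdGaussian P u) (humeas : Measurable u)
    (ξ : Ω → 𝓧) (hξmeas : Measurable ξ)
    (hindep : IndepFun u ξ P)
    (F : EuclideanSpace ℝ (Fin n) → 𝓧 → ℝ)
    (hFmeas : Measurable (Function.uncurry F))
    (f : EuclideanSpace ℝ (Fin n) → ℝ)
    (hunbiased : ∀ x, ∫ ω, F x (ξ ω) ∂P = f x)
    (hmoment : ∀ x, ∫ ω, (F x (ξ ω)) ^ 2 ∂P ≤ σf ^ 2)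
    (hlip : ∀ᵐ ω ∂P, ∀ x y, |F x (ξ ω) - F y (ξ ω)| ≤ M * ‖x - y‖)
    (hgradlip : ∀ᵐ ω ∂P, ∀ x y,
      ‖gradient (fun z => F z (ξ ω)) x - gradient (fun z => F z (ξ ω)) y‖ ≤ L * ‖x - y‖)
    (fν : EuclideanSpace ℝ (Fin n) → ℝ)
    (hfν : ∀ x, fν x = ∫ ω, f (x + ν • u ω) ∂P) :
    ∀ x, ∫ ω, (F (x + ν • u ω) (ξ ω) - fν x) ^ 2 ∂P
      ≤ 4 * M ^ 2 * ν ^ 2 * ((n : ℝ) + 2) + 2 * σf ^ 2 + L ^ 2 * ν ^ 4 * (n : ℝ) ^ 2 := by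
  intro x
  set Y : Ω → ℝ := fun ω => F (x + ν • u ω) (ξ ω)
  set G : Ω → ℝ := fun ω => F x (ξ ω)
  have hF : ∀ v : Ω → EuclideanSpace ℝ (Fin n), Measurable v →
      Measurable fun ω => F (v ω) (ξ ω) := fun v hv => hFmeas.comp (hv.prodMk hξmeas)
  have hYm : Measurable Y := hF _ (by fun_prop)
  have hGm : Measurable G := hF _ (by fun_prop)
  have hsq : ∀ᵐ ω ∂P, (Y ω - G ω) ^ 2 ≤ M ^ 2 * ν ^ 2 * ‖u ω‖ ^ 2 := by
    filter_upwards [hlip] with ω hω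
    have h := hω (x + ν • u ω) x
    rw [add_sub_cancel_left, norm_smul, Real.norm_of_nonneg hν.le] at h
    calc (Y ω - G ω) ^ 2 ≤ (M * (ν * ‖u ω‖)) ^ 2 := sq_le_sq.2 (h.trans (le_abs_self _))
      _ = M ^ 2 * ν ^ 2 * ‖u ω‖ ^ 2 := by ring
  have hbound : Integrable (fun ω => M ^ 2 * ν ^ 2 * ‖u ω‖ ^ 2) P :=
    (hu.integrable_norm_sq humeas).const_mul _
  have hYGint : Integrable (fun ω => (Y ω - G ω) ^ 2) P :=
    hbound.mono' (by fun_prop) <| by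
      filter_upwards [hsq] with ω hω
      rwa [Real.norm_of_nonneg (sq_nonneg _)]
  have hYG : MemLp (fun ω => Y ω - G ω) 2 P :=
    (memLp_two_iff_integrable_sq (by fun_prop)).2 hYGint
  have hdiff : ∫ ω, (Y ω - G ω) ^ 2 ∂P ≤ M ^ 2 * ν ^ 2 * n := by
    rw [← hu.integral_norm_sq humeas, ← integral_const_mul]
    exact integral_mono_ae hYGint hbound hsq
  by_cases hY : MemLp Y 2 P
  · have hG : MemLp G 2 P := by
      simpa [Pi.sub_def] using hY.sub hYG
    have hmean : fν x = ∫ ω, Y ω ∂P := by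
      rw [hfν]
      simp_rw [← hunbiased]
      refine (integral_comp_of_indepFun humeas hξmeas hindep
        (g := fun v s => F (x + ν • v) s) ?_ (hY.integrable one_le_two)).symm
      exact hFmeas.comp (f := fun p : EuclideanSpace ℝ (Fin n) × 𝓧 => (x + ν • p.1, p.2))
        (by fun_prop)
    have hvar : ∫ ω, (Y ω - fν x) ^ 2 ∂P ≤ 2 * (M ^ 2 * ν ^ 2 * n) + 2 * σf ^ 2 := by
      rw [hmean, ← variance_eq_integral hYm.aemeasurable]
      have h := variance_le_two_mul_integral_sq_add hY hG
      linarith [hmoment x]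
    have h₁ : 0 ≤ M ^ 2 * ν ^ 2 * (n : ℝ) := by positivity
    have h₂ : 0 ≤ M ^ 2 * ν ^ 2 := by positivity
    have h₃ : 0 ≤ L ^ 2 * ν ^ 4 * (n : ℝ) ^ 2 := by positivity
    linarith
  · -- The integrand on the left is not integrable, so its Bochner integral vanishes.
    rw [integral_undef]
    · positivity
    · intro hgint
      have h := ((memLp_two_iff_integrable_sq (f := fun ω => Y ω - fν x) (by fun_prop)).2
        hgint).add (memLp_const (fν x))
      exact hY (by simpa [Pi.add_def] using h)
end
end

section
/- Let X ⊆ ℝ^n be a set with M_X = sup_{x ∈ X} ‖x‖ < ∞. Let f_0, f_1, …, f_m : ℝ^n → ℝ be differentiable functions where f_0 has an L_0-Lipschitz gradient and each f_i has an L_i-Lipschitz gradient, let ν_0, ν_1, …, ν_m > 0, and let f_{0,ν_0}, f_{i,ν_i} be the corresponding Gaussian smoothings. Define the Lagrangian L(x, y) = f_0(x) + Σ_{i=1}^m y_i f_i(x), the smoothed Lagrangian L_ν(x, y) = f_{0,ν_0}(x) + Σ_{i=1}^m y_i f_{i,ν_i}(x), and the gap functions Q(z, z̄) = L(x, ȳ)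 − L(x̄, y) and Q_ν(z, z̄) = L_ν(x, ȳ) − L_ν(x̄, y) for z = (x, y), z̄ = (x̄, ȳ). Then for all z = (x, y) and z̄ = (x̄, ȳ) with x, x̄ ∈ X, y, ȳ ∈ ℝ^m with y ≥ 0, ȳ ≥ 0, ‖y‖₂ ≤ M_X and ‖ȳ‖₂ ≤ M_X, one has | Q(z, z̄) − Q_ν(z, z̄) | ≤ ν_0² L_0 n + M_X n ( Σ_{i=1}^m ν_i⁴ L_i² )^{1/2}. -/
open MeasureTheory ProbabilityTheory Real Finset
open scoped RealInnerProductSpace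

noncomputable section

/-- Quadratic remainder bound for a function with an `L`-Lipschitz gradient. -/
lemma abs_sub_sub_inner_gradient_le {E : Type*} [NormedAddCommGroup E] [InnerProductSpace ℝ E]
    [CompleteSpace E] {f : E → ℝ} {L : ℝ} (hf : Differentiable ℝ f)
    (hL : ∀ x y, ‖gradient f x - gradient f y‖ ≤ L * ‖x - y‖) (x h : E) :
    |f (x + h) - f x - ⟪gradient f x, h⟫| ≤ L / 2 * ‖h‖ ^ 2 := by
  have hderiv (t : ℝ) : HasDerivAt (fun t : ℝ => f (x + t • h) - f x - t * ⟪gradient f x, h⟫)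
      ⟪gradient f (x + t • h) - gradient f x, h⟫ t := by
    have hline : HasDerivAt (fun t : ℝ => x + t • h) h t := by
      simpa using ((hasDerivAt_id t).smul_const h).const_add x
    have hcomp := (hf (x + t • h)).hasGradientAt.hasFDerivAt.comp_hasDerivAt t hline
    have hsub := (hcomp.sub_const (f x)).sub
      ((hasDerivAt_id t).mul_const ⟪gradient f x, h⟫)
    refine (hsub.congr_deriv ?_).congr_of_eventuallyEq (.of_forall fun s => ?_) <;>
      simp [inner_sub_left]
  have hbound (t : ℝ) : HasDerivAt (fun t : ℝ => L / 2 * ‖h‖ ^ 2 * t ^ 2) (L * ‖h‖ ^ 2 * t) t := by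
    have hpow := (hasDerivAt_pow 2 t).const_mul (L / 2 * ‖h‖ ^ 2)
    exact hpow.congr_deriv (by push_cast; ring)
  have hmain := image_norm_le_of_norm_deriv_right_le_deriv_boundary
    (a := 0) (b := 1) (fun t _ => (hderiv t).continuousAt.continuousWithinAt)
    (fun t _ => (hderiv t).hasDerivWithinAt) (by simp) hbound
    (fun t ht => ?_) (Set.right_mem_Icc.2 zero_le_one)
  · simpa using hmain
  · calc ‖⟪gradient f (x + t • h) - gradient f x, h⟫‖
        ≤ ‖gradient f (x + t • h) - gradient f x‖ * ‖h‖ := norm_inner_le_norm _ _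
      _ ≤ L * ‖x + t • h - x‖ * ‖h‖ := by gcongr; exact hL _ _
      _ = L * ‖h‖ ^ 2 * t := by
        rw [add_sub_cancel_left, norm_smul, Real.norm_of_nonneg ht.1]
        ring

section StdGaussian

variable {Ω : Type*} [MeasurableSpace Ω] {P : Measure Ω} {n : ℕ}
  {u : Ω → EuclideanSpace ℝ (Fin n)}

lemma IsStdGaussian.hasLaw_apply_s7 (hu : IsStdGaussian P u) (humeas : Measurable u) (i : Fin n) :
    HasLaw (fun ω => u ω i) (gaussianReal 0 1) P where
  aemeasurable := by fun_prop
  map_eq := by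
    have hmeas : Measurable fun ω => (fun i => u ω i) := by fun_prop
    have heval : (fun ω => u ω i) = Function.eval i ∘ fun ω => (fun i => u ω i) := rfl
    rw [heval, ← Measure.map_map (measurable_pi_apply i) hmeas, hu]
    exact (measurePreserving_eval _ i).map_eq

lemma IsStdGaussian.memLp_apply_s7 (hu : IsStdGaussian P u) (humeas : Measurable u) (i : Fin n) :
    MemLp (fun ω => u ω i) 2 P := by
  have hlaw := hu.hasLaw_apply_s7 humeas i
  have hid : MemLp id 2 (Measure.map (fun ω => u ω i) P) := by
    rw [hlaw.map_eq]
    exact memLp_id_gaussianReal 2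
  exact (memLp_map_measure_iff hid.1 hlaw.aemeasurable).1 hid

lemma IsStdGaussian.integral_apply (hu : IsStdGaussian P u) (humeas : Measurable u) (i : Fin n) :
    ∫ ω, u ω i ∂P = 0 := by
  rw [(hu.hasLaw_apply_s7 humeas i).integral_eq, integral_id_gaussianReal]

lemma IsStdGaussian.integral_apply_sq_s7 [IsProbabilityMeasure P] (hu : IsStdGaussian P u)
    (humeas : Measurable u) (i : Fin n) : ∫ ω, u ω i ^ 2 ∂P = 1 := by
  have hvar := (hu.hasLaw_apply_s7 humeas i).variance_eq
  rw [variance_id_gaussianReal, variance_of_integral_eq_zero (by fun_prop)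
    (hu.integral_apply humeas i)] at hvar
  simpa using hvar

lemma IsStdGaussian.integrable_norm_sq_s7 (hu : IsStdGaussian P u) (humeas : Measurable u) :
    Integrable (fun ω => ‖u ω‖ ^ 2) P := by
  simp_rw [EuclideanSpace.real_norm_sq_eq]
  exact integrable_finsetSum _ fun i _ => (hu.memLp_apply_s7 humeas i).integrable_sq

lemma IsStdGaussian.integral_norm_sq_s7 [IsProbabilityMeasure P] (hu : IsStdGaussian P u)
    (humeas : Measurable u) : ∫ ω, ‖u ω‖ ^ 2 ∂P = n := by
  simp_rw [EuclideanSpace.real_norm_sq_eq]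
  rw [integral_finsetSum _ fun i _ => (hu.memLp_apply_s7 humeas i).integrable_sq]
  simp [hu.integral_apply_sq_s7 humeas]

lemma IsStdGaussian.integrable_inner [IsProbabilityMeasure P] (hu : IsStdGaussian P u)
    (humeas : Measurable u) (g : EuclideanSpace ℝ (Fin n)) :
    Integrable (fun ω => ⟪g, u ω⟫) P := by
  simp only [PiLp.inner_apply]
  exact integrable_finsetSum _ fun i _ =>
    (((hu.memLp_apply_s7 humeas i).integrable one_le_two).const_inner (g i))

lemma IsStdGaussian.integral_inner [IsProbabilityMeasure P] (hu : IsStdGaussian P u)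
    (humeas : Measurable u) (g : EuclideanSpace ℝ (Fin n)) :
    ∫ ω, ⟪g, u ω⟫ ∂P = 0 := by
  have hint (i : Fin n) := (hu.memLp_apply_s7 humeas i).integrable one_le_two
  simp only [PiLp.inner_apply]
  rw [integral_finsetSum _ fun i _ => (hint i).const_inner (g i)]
  exact Finset.sum_eq_zero fun i _ => by
    rw [_root_.integral_inner (hint i), hu.integral_apply humeas i, inner_zero_right]

/-- Gaussian smoothing changes a function with an `L`-Lipschitz gradient by at most
`ν² L n / 2`. -/
lemma IsStdGaussian.abs_sub_integral_le [IsProbabilityMeasure P] (hu : IsStdGaussian P u)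
    (humeas : Measurable u) {f : EuclideanSpace ℝ (Fin n) → ℝ} {L : ℝ}
    (hf : Differentiable ℝ f)
    (hL : ∀ x y, ‖gradient f x - gradient f y‖ ≤ L * ‖x - y‖) (ν : ℝ)
    (x : EuclideanSpace ℝ (Fin n)) :
    |f x - ∫ ω, f (x + ν • u ω) ∂P| ≤ ν ^ 2 * L * n / 2 := by
  set r : Ω → ℝ := fun ω => f (x + ν • u ω) - f x - ν * ⟪gradient f x, u ω⟫ with hr
  have hbound (ω : Ω) : ‖r ω‖ ≤ L / 2 * ν ^ 2 * ‖u ω‖ ^ 2 := by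
    have h := abs_sub_sub_inner_gradient_le hf hL x (ν • u ω)
    rw [inner_smul_right, norm_smul, mul_pow, Real.norm_eq_abs, sq_abs, ← mul_assoc] at h
    exact h
  have hdom := (hu.integrable_norm_sq_s7 humeas).const_mul (L / 2 * ν ^ 2)
  have hfmeas : Measurable f := hf.continuous.measurable
  have hrmeas : Measurable r := by fun_prop
  have hrint : Integrable r P := hdom.mono' hrmeas.aestronglyMeasurable (.of_forall hbound)
  have hinner := (hu.integrable_inner humeas (gradient f x)).const_mul ν
  have hsum : ∫ ω, f (x + ν • u ω) ∂P = ∫ ω, r ω ∂P + f x := by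
    have heq : (fun ω => f (x + ν • u ω)) = fun ω => r ω + (f x + ν * ⟪gradient f x, u ω⟫) := by
      funext ω
      simp only [hr]
      ring
    rw [heq, integral_add hrint (.fun_add (integrable_const _) hinner),
      integral_add (integrable_const _) hinner, integral_const_mul, hu.integral_inner humeas]
    simp
  calc |f x - ∫ ω, f (x + ν • u ω) ∂P| = ‖∫ ω, r ω ∂P‖ := by
        rw [hsum, Real.norm_eq_abs, ← abs_neg]
        congr 1
        ring
    _ ≤ ∫ ω, L / 2 * ν ^ 2 * ‖u ω‖ ^ 2 ∂P :=
        norm_integral_le_of_norm_le hdom (.of_forall hbound)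
    _ = ν ^ 2 * L * n / 2 := by
        rw [integral_const_mul, hu.integral_norm_sq_s7 humeas]
        ring

end StdGaussian

/-- Cauchy–Schwarz for a weighted sum with coordinatewise bounds. -/
lemma abs_sum_mul_le_of_abs_le {ι : Type*} [Fintype ι] {y d c : ι → ℝ} {M : ℝ}
    (hd : ∀ i, |d i| ≤ c i) (hy : √(∑ i, y i ^ 2) ≤ M) :
    |∑ i, y i * d i| ≤ M * √(∑ i, c i ^ 2) := by
  have hsq : ∑ i, d i ^ 2 ≤ ∑ i, c i ^ 2 :=
    Finset.sum_le_sum fun i _ => sq_le_sq' (abs_le.1 (hd i)).1 (abs_le.1 (hd i)).2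
  calc |∑ i, y i * d i| ≤ √((∑ i, y i ^ 2) * ∑ i, d i ^ 2) :=
        Real.abs_le_sqrt (Finset.sum_mul_sq_le_sq_mul_sq _ _ _)
    _ = √(∑ i, y i ^ 2) * √(∑ i, d i ^ 2) :=
        Real.sqrt_mul (Finset.sum_nonneg fun i _ => sq_nonneg _) _
    _ ≤ M * √(∑ i, c i ^ 2) := by
        gcongr
        exact (Real.sqrt_nonneg _).trans hy

/-- Lemma on the gap functions: for the Lagrangian `L(x,y)` and its
smoothed version `L_ν(x,y)`, the corresponding gap functions `Q` and `Q_ν` satisfy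
`|Q(z, z̄) − Q_ν(z, z̄)| ≤ ν₀² L₀ n + M_X n (Σ ν_i⁴ L_i²)^{1/2}` whenever the dual
variables have Euclidean norm at most `M_X = sup_{x ∈ X} ‖x‖`. -/
theorem statement7
    {n m : ℕ}
    {Ω : Type*} [MeasurableSpace Ω] (P : Measure Ω) [IsProbabilityMeasure P]
    (X : Set (EuclideanSpace ℝ (Fin n))) (M_X : ℝ)
    (hMX : IsLUB ((fun x => ‖x‖) '' X) M_X)
    (f0 : EuclideanSpace ℝ (Fin n) → ℝ) (f : Fin m → EuclideanSpace ℝ (Fin n) → ℝ)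
    (L0 : ℝ) (L : Fin m → ℝ)
    (hdiff0 : Differentiable ℝ f0) (hdiff : ∀ i, Differentiable ℝ (f i))
    (hgradlip0 : ∀ x y, ‖gradient f0 x - gradient f0 y‖ ≤ L0 * ‖x - y‖)
    (hgradlip : ∀ i x y, ‖gradient (f i) x - gradient (f i) y‖ ≤ L i * ‖x - y‖)
    (ν0 : ℝ) (ν : Fin m → ℝ) (hν0 : 0 < ν0) (hν : ∀ i, 0 < ν i)
    (u : Ω → EuclideanSpace ℝ (Fin n))
    (hu : IsStdGaussian P u) (humeas : Measurable u)
    (f0ν : EuclideanSpace ℝ (Fin n) → ℝ)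
    (hf0ν : ∀ x, f0ν x = ∫ ω, f0 (x + ν0 • u ω) ∂P)
    (fν : Fin m → EuclideanSpace ℝ (Fin n) → ℝ)
    (hfν : ∀ i x, fν i x = ∫ ω, f i (x + ν i • u ω) ∂P)
    (Lag Lagν : EuclideanSpace ℝ (Fin n) → (Fin m → ℝ) → ℝ)
    (hLag : ∀ x y, Lag x y = f0 x + ∑ i, y i * f i x)
    (hLagν : ∀ x y, Lagν x y = f0ν x + ∑ i, y i * fν i x) :
    ∀ x xb : EuclideanSpace ℝ (Fin n), ∀ y yb : Fin m → ℝ,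
      x ∈ X → xb ∈ X → (∀ i, 0 ≤ y i) → (∀ i, 0 ≤ yb i) →
      Real.sqrt (∑ i, (y i) ^ 2) ≤ M_X → Real.sqrt (∑ i, (yb i) ^ 2) ≤ M_X →
      |(Lag x yb - Lag xb y) - (Lagν x yb - Lagν xb y)|
        ≤ ν0 ^ 2 * L0 * (n : ℝ)
          + M_X * (n : ℝ) * Real.sqrt (∑ i, (ν i) ^ 4 * (L i) ^ 2) := by
  intro x xb y yb _ _ _ _ hy hyb
  have hsmooth0 (z) : |f0 z - f0ν z| ≤ ν0 ^ 2 * L0 * n / 2 := by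
    rw [hf0ν]
    exact hu.abs_sub_integral_le humeas hdiff0 hgradlip0 ν0 z
  have hsmooth (z) (i : Fin m) : |f i z - fν i z| ≤ ν i ^ 2 * L i * n / 2 := by
    rw [hfν]
    exact hu.abs_sub_integral_le humeas (hdiff i) (hgradlip i) (ν i) z
  have hc : √(∑ i, (ν i ^ 2 * L i * n / 2) ^ 2) = n / 2 * √(∑ i, ν i ^ 4 * L i ^ 2) := by
    have hsum : ∑ i, (ν i ^ 2 * L i * n / 2) ^ 2
        = (n / 2 : ℝ) ^ 2 * ∑ i, ν i ^ 4 * L i ^ 2 := by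
      rw [Finset.mul_sum]
      exact Finset.sum_congr rfl fun i _ => by ring
    rw [hsum, Real.sqrt_mul (by positivity), Real.sqrt_sq (by positivity)]
  have hdual := abs_sum_mul_le_of_abs_le (hsmooth xb) hy
  have hdualb := abs_sum_mul_le_of_abs_le (hsmooth x) hyb
  have hdx := hsmooth0 x
  have hdxb := hsmooth0 xb
  rw [hc] at hdual hdualb
  simp only [mul_sub, Finset.sum_sub_distrib] at hdual hdualb
  rw [hLag, hLag, hLagν, hLagν]
  rw [abs_le] at *
  constructor <;> linarith
end
end
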